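/- arXiv:1512.01519 — 2 statements merged into one kernel-verified Lean document; each statement's English description precedes it below -/
import Mathlib

section
/- Let M and N be finite-dimensional vector spaces over a field, each equipped with a decomposition indexed by nonnegative rationals (slope decompositions) with respect to a decreasing filtration (G^t)_{t≥0} of a group G acting on them, where M is isoclinic of slope r (i.e., M^{G^r} = 0 and G^{r+} acts trivially on M) and N is isoclinic of slope s with r > s. Then the tensor product M ⊗ N is isoclinic of slope r, i.e., (M ⊗ N)^{G^r} = 0 and G^{r+} acts trivially on M ⊗ N. -/
open scoped TensorProduct

/-- The subspace of vectors fixed by every element of the subgroup `H`. -/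
def fixedSub {k G V : Type*} [Field k] [Group G] [AddCommGroup V] [Module k V]
    (ρ : Representation k G V) (H : Subgroup G) : Submodule k V :=
  ⨅ g ∈ H, LinearMap.ker (ρ g - LinearMap.id)

/-- The subgroup `H` acts trivially via `ρ`. -/
def ActsTrivially {k G V : Type*} [Field k] [Group G] [AddCommGroup V] [Module k V]
    (ρ : Representation k G V) (H : Subgroup G) : Prop :=
  ∀ g ∈ H, ∀ v : V, ρ g v = v

/-- the tensor product of isoclinic representations of slopes `r > s`
is isoclinic of slope `r`. -/
theorem isoclinic_tensor
    {k G V W : Type*} [Field k] [Group G]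
    [AddCommGroup V] [Module k V] [FiniteDimensional k V]
    [AddCommGroup W] [Module k W] [FiniteDimensional k W]
    (ρM : Representation k G V) (ρN : Representation k G W)
    (Φ Φplus : ℚ → Subgroup G)
    (hΦ : AntitoneOn Φ (Set.Ici 0)) (hΦp : AntitoneOn Φplus (Set.Ici 0))
    (hlt : ∀ a b : ℚ, 0 ≤ a → a < b → Φ b ≤ Φplus a)
    (r s : ℚ) (hs : 0 ≤ s) (hrs : s < r)
    (hM0 : fixedSub ρM (Φ r) = ⊥) (hM1 : ActsTrivially ρM (Φplus r))
    (hN0 : fixedSub ρN (Φ s) = ⊥) (hN1 : ActsTrivially ρN (Φplus s)) :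
    fixedSub (ρM.tprod ρN) (Φ r) = ⊥ ∧ ActsTrivially (ρM.tprod ρN) (Φplus r) := by
  have hr : 0 ≤ r := hs.trans hrs.le
  constructor
  · rw [eq_bot_iff]
    intro x hx
    rw [Submodule.mem_bot]
    simp only [fixedSub, Submodule.mem_iInf, LinearMap.mem_ker, LinearMap.sub_apply,
      LinearMap.id_apply, sub_eq_zero] at hx
    let b := Module.finBasis k W
    let e := TensorProduct.equivFinsuppOfBasisRight (M := V) b
    have key : ∀ g ∈ Φ r, ∀ y : V ⊗[k] W, ∀ i, e (ρM.tprod ρN g y) i = ρM g (e y i) := by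
      intro g hg y i
      have hgN : ∀ w, ρN g w = w := hN1 g (hlt s r hs hrs hg)
      induction y using TensorProduct.induction_on with
      | zero => simp
      | tmul v w =>
        simp [e, Representation.tprod_apply, hgN]
      | add y z hy hz => simp only [map_add, Finsupp.add_apply, hy, hz]
    apply e.injective
    rw [map_zero]
    ext i
    have hmem : e x i ∈ fixedSub ρM (Φ r) := by
      simp only [fixedSub, Submodule.mem_iInf, LinearMap.mem_ker, LinearMap.sub_apply,
        LinearMap.id_apply, sub_eq_zero]
      intro g hg
      rw [← key g hg, hx g hg]
    rw [hM0, Submodule.mem_bot] at hmem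
    simpa using hmem
  · intro g hg y
    have hgN : ∀ w, ρN g w = w := hN1 g (hΦp hs hr hrs.le hg)
    have hgM : ∀ v, ρM g v = v := hM1 g hg
    induction y using TensorProduct.induction_on with
    | zero => simp
    | tmul v w => simp [Representation.tprod_apply, hgN, hgM]
    | add y z hy hz => simp only [map_add, hy, hz]
end

section
/- Let M be a finite-dimensional representation of a group G with slope decomposition M = ⊕_{r ∈ ℚ≥0} M^{(r)}, where each M^{(r)} is isoclinic of slope r (zero for all but finitely many r). If N is a one-dimensional representation of G which is isoclinic of slope m > 0, then for every slope r < m, the tensor product M^{(r)} ⊗ N is isoclinic of slope m, and for every slope r > m, M^{(r)} ⊗ N is isoclinic of slope r. -/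
open scoped TensorProduct

/-- A `G`-stable subspace `W` is isoclinic of slope `r`: its `Φ r`-fixed part is `0`
and `Φplus r` acts trivially on it. -/
def IsoclinicOn {k G V : Type*} [Field k] [Group G] [AddCommGroup V] [Module k V]
    (ρ : Representation k G V) (Φ Φplus : ℚ → Subgroup G) (r : ℚ)
    (W : Submodule k V) : Prop :=
  fixedSub ρ (Φ r) ⊓ W = ⊥ ∧ ∀ g ∈ Φplus r, ∀ v ∈ W, ρ g v = v

theorem mem_fixedSub_iff' {k G V : Type*} [Field k] [Group G] [AddCommGroup V] [Module k V]
    (ρ : Representation k G V) (H : Subgroup G) (v : V) :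
    v ∈ fixedSub ρ H ↔ ∀ g ∈ H, ρ g v = v := by
  simp [fixedSub, Submodule.mem_iInf, sub_eq_zero]

theorem tmul_inj_of_ne_zero {k V L : Type*} [Field k] [AddCommGroup V] [Module k V]
    [AddCommGroup L] [Module k L] {e : L} (he : e ≠ 0) {v w : V}
    (h : v ⊗ₜ[k] e = w ⊗ₜ[k] e) : v = w := by
  have : ∃ f : Module.Dual k L, f e ≠ 0 := by
    by_contra! hc
    exact he ((Module.forall_dual_apply_eq_zero_iff k e).1 hc)
  obtain ⟨f, hf⟩ := this
  have h2 := congrArg (fun t => TensorProduct.rid k V (TensorProduct.map LinearMap.id f t)) h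
  simp only [TensorProduct.map_tmul, LinearMap.id_apply, TensorProduct.rid_tmul] at h2
  exact smul_right_injective V hf h2

theorem exists_tmul_of_mem_range {k V L : Type*} [Field k] [AddCommGroup V] [Module k V]
    [AddCommGroup L] [Module k L] {e : L} (he : ∀ w : L, ∃ c : k, c • e = w)
    (W : Submodule k V) (x : V ⊗[k] L)
    (hx : x ∈ LinearMap.range (TensorProduct.map W.subtype (LinearMap.id : L →ₗ[k] L))) :
    ∃ w ∈ W, x = w ⊗ₜ[k] e := by
  obtain ⟨y, rfl⟩ := hx
  induction y using TensorProduct.induction_on with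
  | zero => exact ⟨0, W.zero_mem, by simp⟩
  | tmul a b =>
    obtain ⟨c, rfl⟩ := he b
    exact ⟨c • (a : V), W.smul_mem c a.2, by simp [TensorProduct.smul_tmul]⟩
  | add a b ha hb =>
    obtain ⟨w, hw, h1⟩ := ha
    obtain ⟨w', hw', h2⟩ := hb
    exact ⟨w + w', W.add_mem hw hw', by rw [map_add, h1, h2, TensorProduct.add_tmul]⟩

/-- with `M = ⊕_{r∈S} M^{(r)}` a slope decomposition and `N`
one-dimensional isoclinic of slope `m > 0`, the piece `M^{(r)} ⊗ N` is isoclinic of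
slope `m` when `r < m` and of slope `r` when `r > m`. -/
theorem tensor_pieces_isoclinic
    {k G V L : Type*} [Field k] [Group G]
    [AddCommGroup V] [Module k V] [FiniteDimensional k V]
    [AddCommGroup L] [Module k L] (hL : Module.finrank k L = 1)
    (ρM : Representation k G V) (ρN : Representation k G L)
    (Φ Φplus : ℚ → Subgroup G)
    (hΦ : AntitoneOn Φ (Set.Ici 0)) (hΦp : AntitoneOn Φplus (Set.Ici 0))
    (hlt : ∀ a b : ℚ, 0 ≤ a → a < b → Φ b ≤ Φplus a)
    (S : Finset ℚ) (W : ℚ → Submodule k V)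
    (hSnn : ∀ r ∈ S, 0 ≤ r)
    (hnonzero : ∀ r ∈ S, W r ≠ ⊥)
    (hstable : ∀ r ∈ S, ∀ g : G, ∀ v ∈ W r, ρM g v ∈ W r)
    (hinternal : DirectSum.IsInternal (fun r : S => W (r : ℚ)))
    (hiso : ∀ r ∈ S, IsoclinicOn ρM Φ Φplus r (W r))
    (m : ℚ) (hm : 0 < m)
    (hN0 : fixedSub ρN (Φ m) = ⊥) (hN1 : ActsTrivially ρN (Φplus m)) :
    ∀ r ∈ S,
      (r < m → IsoclinicOn (ρM.tprod ρN) Φ Φplus m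
        (LinearMap.range (TensorProduct.map (W r).subtype (LinearMap.id : L →ₗ[k] L)))) ∧
      (m < r → IsoclinicOn (ρM.tprod ρN) Φ Φplus r
        (LinearMap.range (TensorProduct.map (W r).subtype (LinearMap.id : L →ₗ[k] L)))) := by
  intro r hr
  obtain ⟨e, he0, he⟩ := finrank_eq_one_iff'.1 hL
  obtain ⟨hi0, hi1⟩ := hiso r hr
  have hr0 := hSnn r hr
  refine ⟨fun hrm => ⟨?_, ?_⟩, fun hmr => ⟨?_, ?_⟩⟩
  · rw [eq_bot_iff]
    rintro x ⟨hx1, hx2⟩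
    obtain ⟨w, hw, rfl⟩ := exists_tmul_of_mem_range he _ x hx2
    rw [SetLike.mem_coe, mem_fixedSub_iff'] at hx1
    by_contra hne
    have hw0 : w ≠ 0 := by
      rintro rfl
      exact hne (by simp)
    have hfix : e ∈ fixedSub ρN (Φ m) := by
      rw [mem_fixedSub_iff']
      intro g hg
      have h1 := hx1 g hg
      rw [Representation.tprod_apply, TensorProduct.map_tmul,
        hi1 g (hlt r m hr0 hrm hg) w hw] at h1
      have h2 := congrArg (TensorProduct.comm k V L) h1
      simp only [TensorProduct.comm_tmul] at h2
      exact tmul_inj_of_ne_zero hw0 h2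
    rw [hN0] at hfix
    exact he0 (by simpa using hfix)
  · intro g hg x hx
    obtain ⟨w, hw, rfl⟩ := exists_tmul_of_mem_range he _ x hx
    rw [Representation.tprod_apply, TensorProduct.map_tmul, hN1 g hg,
      hi1 g (hΦp (Set.mem_Ici.2 hr0) (Set.mem_Ici.2 hm.le) hrm.le hg) w hw]
  · rw [eq_bot_iff]
    rintro x ⟨hx1, hx2⟩
    obtain ⟨w, hw, rfl⟩ := exists_tmul_of_mem_range he _ x hx2
    rw [SetLike.mem_coe, mem_fixedSub_iff'] at hx1
    have hfix : w ∈ fixedSub ρM (Φ r) ⊓ W r := by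
      refine ⟨(mem_fixedSub_iff' _ _ _).2 fun g hg => ?_, hw⟩
      have h1 := hx1 g hg
      rw [Representation.tprod_apply, TensorProduct.map_tmul,
        hN1 g (hlt m r hm.le hmr hg)] at h1
      exact tmul_inj_of_ne_zero he0 h1
    rw [hi0, Submodule.mem_bot] at hfix
    simp [hfix]
  · intro g hg x hx
    obtain ⟨w, hw, rfl⟩ := exists_tmul_of_mem_range he _ x hx
    rw [Representation.tprod_apply, TensorProduct.map_tmul, hi1 g hg w hw,
      hN1 g (hΦp (Set.mem_Ici.2 hm.le) (Set.mem_Ici.2 hr0) hmr.le hg)]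
end
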